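/- arXiv:1909.11584 — 3 statements merged into one kernel-verified Lean document; each statement's English description precedes it below -/
import Mathlib

section
/- Under Assumptions (A), (B), (C), there exists a constant κ > 0, independent of the choice of the continuous prior curve ν : [0,T] → 𝒫, such that every solution (Θ, π) of the time-inconsistent Hamilton–Jacobi system with prior ν satisfies 0 ≤ Θ_{τ,t}(i) ≤ κ for all τ, t ∈ [0,T] and all i ∈ M. -/
open MeasureTheory Filter Set Topology

/-- A probability vector on `Fin m`. -/
def IsProbVec {m : ℕ} (ρ : Fin m → ℝ) : Prop :=
  (∀ i, 0 ≤ ρ i) ∧ ∑ i, ρ i = 1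

/-- The `ℓ¹` distance `d(ρ,γ) = ∑ i |ρ i - γ i|`. -/
noncomputable def probDist {m : ℕ} (ρ γ : Fin m → ℝ) : ℝ :=
  ∑ i, |ρ i - γ i|

/-- The Dirac vector at `i`. -/
def diracVec {m : ℕ} (i : Fin m) : Fin m → ℝ := fun j => if j = i then 1 else 0

/-- `f` is right-continuous with left limits on `[0,T]`. -/
def RCLLOn {X : Type*} [TopologicalSpace X] (f : ℝ → X) (T : ℝ) : Prop :=
  (∀ t ∈ Set.Ico (0:ℝ) T, Filter.Tendsto f (nhdsWithin t (Set.Ioc t T)) (nhds (f t))) ∧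
  (∀ t ∈ Set.Ioc (0:ℝ) T, ∃ L : X, Filter.Tendsto f (nhdsWithin t (Set.Ico 0 t)) (nhds L))

/-- `f` is right-continuous with left limits on the interval `[a, b)`. -/
def RCLLOnIco {X : Type*} [TopologicalSpace X] (f : ℝ → X) (a b : ℝ) : Prop :=
  (∀ t ∈ Set.Ico a b, Filter.Tendsto f (nhdsWithin t (Set.Ioo t b)) (nhds (f t))) ∧
  (∀ t ∈ Set.Ioo a b, ∃ L : X, Filter.Tendsto f (nhdsWithin t (Set.Ico a t)) (nhds L))

/-- The data of the time-inconsistent controlled Markov chain model, together with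
Assumptions (A), (B) and (C) of the paper. -/
structure TIModel (m : ℕ) (U : Type*) [MetricSpace U] where
  /-- the time horizon -/
  T : ℝ
  T_pos : 0 < T
  /-- a fixed reference action -/
  v₀ : U
  /-- the admissible action sets `U_t(i)` -/
  Uset : ℝ → Fin m → Set U
  Uset_nonempty : ∀ t ∈ Set.Icc (0:ℝ) T, ∀ i, (Uset t i).Nonempty
  /-- the transition rates `q_t^v(i,j)` -/
  q : ℝ → Fin m → U → Fin m → ℝ
  q_nonneg : ∀ t ∈ Set.Icc (0:ℝ) T, ∀ i, ∀ v ∈ Uset t i, ∀ j, j ≠ i → 0 ≤ q t i v j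
  q_rowsum : ∀ t ∈ Set.Icc (0:ℝ) T, ∀ i, ∀ v ∈ Uset t i, ∑ j, q t i v j = 0
  κ₁ : ℝ
  κ₁_pos : 0 < κ₁
  /-- (A3): Lipschitz dependence of the rates on the action -/
  q_lip : ∀ t ∈ Set.Icc (0:ℝ) T, ∀ (i j : Fin m), ∀ v ∈ Uset t i, ∀ v' ∈ Uset t i,
    |q t i v j - q t i v' j| ≤ κ₁ * dist v v'
  K₁ : ℝ
  K₁_pos : 0 < K₁
  /-- (A3): uniform bound on the rates -/
  q_bdd : ∀ t ∈ Set.Icc (0:ℝ) T, ∀ (i j : Fin m), ∀ v ∈ Uset t i, |q t i v j| ≤ K₁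
  /-- (A1)-(A2): right-continuity of the rates along admissible actions -/
  q_rc : ∀ t ∈ Set.Ico (0:ℝ) T, ∀ (i j : Fin m), ∀ (tn : ℕ → ℝ) (vn : ℕ → U) (v : U),
    (∀ n, tn n ∈ Set.Icc (0:ℝ) T) → (∀ n, t < tn n) →
    Filter.Tendsto tn Filter.atTop (nhds t) →
    (∀ n, vn n ∈ Uset (tn n) i) → v ∈ Uset t i →
    Filter.Tendsto vn Filter.atTop (nhds v) →
    Filter.Tendsto (fun n => q (tn n) i (vn n) j) Filter.atTop (nhds (q t i v j))
  /-- (A1)-(A2): existence of left limits of the rates along admissible actions -/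
  q_ll : ∀ t ∈ Set.Ioc (0:ℝ) T, ∀ (i j : Fin m), ∀ (tn : ℕ → ℝ) (vn : ℕ → U) (v : U),
    (∀ n, tn n ∈ Set.Icc (0:ℝ) T) → (∀ n, tn n < t) →
    Filter.Tendsto tn Filter.atTop (nhds t) →
    (∀ n, vn n ∈ Uset (tn n) i) →
    Filter.Tendsto vn Filter.atTop (nhds v) →
    ∃ L : ℝ, Filter.Tendsto (fun n => q (tn n) i (vn n) j) Filter.atTop (nhds L)
  /-- the distribution-dependent part `f̄_{τ,t}(i;ρ)` of the running cost -/
  fbar : ℝ → ℝ → Fin m → (Fin m → ℝ) → ℝ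
  /-- the action-dependent part `Ψ_t(i,v)` of the running cost -/
  Ψ : ℝ → Fin m → U → ℝ
  /-- the terminal cost `g_τ(i;ρ)` -/
  g : ℝ → Fin m → (Fin m → ℝ) → ℝ
  /-- (B1): continuity of `Ψ` -/
  Ψ_cont : ∀ t ∈ Set.Icc (0:ℝ) T, ∀ i, ContinuousOn (Ψ t i) (Uset t i)
  Ψ_nonneg : ∀ t ∈ Set.Icc (0:ℝ) T, ∀ i, ∀ v ∈ Uset t i, 0 ≤ Ψ t i v
  Ψ_le : ∀ t ∈ Set.Icc (0:ℝ) T, ∀ i, ∀ v ∈ Uset t i, Ψ t i v ≤ K₁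
  K₂ : ℝ
  K₃ : ℝ
  /-- (B2): bounds on `f̄` and `g` -/
  fbar_nonneg : ∀ τ t i ρ, IsProbVec ρ → 0 ≤ fbar τ t i ρ
  fbar_le : ∀ τ t i ρ, IsProbVec ρ → fbar τ t i ρ ≤ K₂
  g_nonneg : ∀ τ i ρ, IsProbVec ρ → 0 ≤ g τ i ρ
  g_le : ∀ τ i ρ, IsProbVec ρ → g τ i ρ ≤ K₂
  /-- (B2): Lipschitz dependence of `f̄` and `g` on the distribution -/
  fg_lip : ∀ τ t i ρ ρ', IsProbVec ρ → IsProbVec ρ' →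
    |fbar τ t i ρ - fbar τ t i ρ'| + |g τ i ρ - g τ i ρ'| ≤ K₃ * probDist ρ ρ'
  /-- (B3): the argmin selection map `ψ_t[h](i)` -/
  ψ : ℝ → (Fin m → ℝ) → Fin m → U
  ψ_mem : ∀ t ∈ Set.Icc (0:ℝ) T, ∀ (h : Fin m → ℝ) (i : Fin m), ψ t h i ∈ Uset t i
  ψ_argmin : ∀ t ∈ Set.Icc (0:ℝ) T, ∀ (h : Fin m → ℝ) (i : Fin m), ∀ v ∈ Uset t i,
    Ψ t i (ψ t h i) + ∑ j, h j * q t i (ψ t h i) j ≤ Ψ t i v + ∑ j, h j * q t i v j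
  κ₂ : ℝ
  κ₂_pos : 0 < κ₂
  /-- (B3): Lipschitz dependence of `ψ` on `h` -/
  ψ_lip : ∀ t ∈ Set.Icc (0:ℝ) T, ∀ (h h' : Fin m → ℝ) (i : Fin m),
    dist (ψ t h i) (ψ t h' i) ≤ κ₂ * ⨆ j, |h j - h' j|
  /-- (B3): continuity of `ψ` in time -/
  ψ_timecont : ∀ t ∈ Set.Icc (0:ℝ) T, ∀ (h : Fin m → ℝ) (i : Fin m),
    Filter.Tendsto (fun s => ψ s h i) (nhdsWithin t (Set.Icc (0:ℝ) T)) (nhds (ψ t h i))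
  /-- (C): regularity of `f̄` and `g` in the discounting variable `τ` -/
  fbar_rcll : ∀ t ∈ Set.Icc (0:ℝ) T, ∀ i ρ, IsProbVec ρ → RCLLOn (fun τ => fbar τ t i ρ) T
  g_rcll : ∀ i ρ, IsProbVec ρ → RCLLOn (fun τ => g τ i ρ) T

namespace TIModel

variable {m : ℕ} {U : Type*} [MetricSpace U]

/-- An admissible strategy: `π_t(i) ∈ U_t(i)` with integrable distance to `v₀`. -/
def IsAdmissible (M : TIModel m U) (π : ℝ → Fin m → U) : Prop :=
  (∀ t ∈ Set.Icc (0:ℝ) M.T, ∀ i, π t i ∈ M.Uset t i) ∧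
  ∀ i, MeasureTheory.IntegrableOn (fun s => dist (π s i) M.v₀) (Set.Icc (0:ℝ) M.T)

/-- A càdlàg admissible strategy, i.e. an element of `D([0,T],𝒰)`. -/
def IsCadlagAdmissible (M : TIModel m U) (π : ℝ → Fin m → U) : Prop :=
  M.IsAdmissible π ∧ ∀ i, RCLLOn (fun t => π t i) M.T

/-- A continuous curve of probability vectors, i.e. an element of `C([0,T],𝒫)`. -/
def IsContinuousPrior (M : TIModel m U) (ν : ℝ → Fin m → ℝ) : Prop :=
  (∀ t ∈ Set.Icc (0:ℝ) M.T, IsProbVec (ν t)) ∧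
  ∀ j, ContinuousOn (fun t => ν t j) (Set.Icc (0:ℝ) M.T)

/-- `μ` is the solution of the forward (Kolmogorov) equation on `[t₀,T]` under the
strategy `π` with initial datum `ρ` at time `t₀`, i.e. `μ_s = μ_s^{t₀,ρ,π}`. -/
def IsForwardSol (M : TIModel m U) (π : ℝ → Fin m → U) (t₀ : ℝ)
    (ρ : Fin m → ℝ) (μ : ℝ → Fin m → ℝ) : Prop :=
  (∀ j, ContinuousOn (fun s => μ s j) (Set.Icc t₀ M.T)) ∧
  ∀ s ∈ Set.Icc t₀ M.T, ∀ j,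
    μ s j = ρ j + ∫ r in t₀..s, ∑ i, μ r i * M.q r i (π r i) j

/-- The cost `J_{τ,t}(φ_t[π]; ν)` computed along a distribution curve `μ`
(to be taken the forward solution started from a Dirac mass at time `t`):
`∫_t^T ∑_j f_{τ,s}(j, π_s(j); ν_s) μ_s(j) ds + ∑_j g_τ(j; ν_T) μ_T(j)`. -/
noncomputable def costJ (M : TIModel m U) (ν : ℝ → Fin m → ℝ)
    (π : ℝ → Fin m → U) (μ : ℝ → Fin m → ℝ) (τ t : ℝ) : ℝ :=
  (∫ s in t..M.T, ∑ j, (M.fbar τ s j (ν s) + M.Ψ s j (π s j)) * μ s j) +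
  ∑ j, M.g τ j (ν M.T) * μ M.T j

/-- `(Θ, π)` solves the time-inconsistent Hamilton-Jacobi system (3.3)/(3.4) with
prior `ν`: `π_t(i) = ψ_t[Θ_{t,t}](i)`, `t ↦ Θ_{τ,t}(i)` is continuous, and for each `τ`,
`(d/dt)Θ_{τ,t}(i) + f_{τ,t}(i,π_t(i);ν_t) + ∑_j q_t^{π_t(i)}(i,j) Θ_{τ,t}(j) = 0`,
`Θ_{τ,T}(i) = g_τ(i;ν_T)` (in integrated form). -/
def IsHJSol (M : TIModel m U) (ν : ℝ → Fin m → ℝ)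
    (Θ : ℝ → ℝ → Fin m → ℝ) (π : ℝ → Fin m → U) : Prop :=
  (∀ t ∈ Set.Icc (0:ℝ) M.T, ∀ i, π t i = M.ψ t (fun j => Θ t t j) i) ∧
  (∀ τ ∈ Set.Icc (0:ℝ) M.T, ∀ i, ContinuousOn (fun t => Θ τ t i) (Set.Icc (0:ℝ) M.T)) ∧
  (∀ τ ∈ Set.Icc (0:ℝ) M.T, ∀ i, Θ τ M.T i = M.g τ i (ν M.T)) ∧
  ∀ τ ∈ Set.Icc (0:ℝ) M.T, ∀ t ∈ Set.Icc (0:ℝ) M.T, ∀ i,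
    Θ τ t i = M.g τ i (ν M.T) + ∫ s in t..M.T,
      ((M.fbar τ s i (ν s) + M.Ψ s i (π s i)) + ∑ j, M.q s i (π s i) j * Θ τ s j)

/-- The concatenated strategy `πp ⊕ φ_c[π]`: equal to `πp` before time `c` and to `π`
from time `c` on. -/
noncomputable def oplus (πp π : ℝ → Fin m → U) (c : ℝ) : ℝ → Fin m → U :=
  fun s => if s < c then πp s else π s

/-- A càdlàg admissible perturbation on `[t, t+ε)`, i.e. an element of `D([t,t+ε),𝒰)`. -/
def IsPerturbation (M : TIModel m U) (t ε : ℝ) (πp : ℝ → Fin m → U) : Prop :=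
  (∀ s ∈ Set.Ico t (t + ε), ∀ i, πp s i ∈ M.Uset s i) ∧
  ∀ i, RCLLOnIco (fun s => πp s i) t (t + ε)

/-- `(ρ, π)` is a time-inconsistent distribution-dependent equilibrium: with
`ν = μ^{0,ρ,π}` the induced distribution curve, for every `t`, `i` and every family of
càdlàg admissible perturbations `πp ε` on `[t,t+ε)`,
`liminf_{ε→0⁺} ε⁻¹ (V_t(i, πpε ⊕ φ_{t+ε}[π]; ν) - V_t(i, φ_t[π]; ν)) ≥ 0`. -/
def IsEquilibrium (M : TIModel m U) (ρ : Fin m → ℝ) (π : ℝ → Fin m → U) : Prop :=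
  M.IsCadlagAdmissible π ∧
  ∀ ν : ℝ → Fin m → ℝ, M.IsForwardSol π 0 ρ ν →
  ∀ t ∈ Set.Ico (0:ℝ) M.T, ∀ i : Fin m,
  ∀ πp : ℝ → ℝ → Fin m → U,
    (∀ ε ∈ Set.Ioo (0:ℝ) (M.T - t), M.IsPerturbation t ε (πp ε)) →
  ∀ μ₀ : ℝ → Fin m → ℝ, M.IsForwardSol π t (diracVec i) μ₀ →
  ∀ μp : ℝ → ℝ → Fin m → ℝ,
    (∀ ε ∈ Set.Ioo (0:ℝ) (M.T - t),
      M.IsForwardSol (oplus (πp ε) π (t + ε)) t (diracVec i) (μp ε)) →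
  ∀ δ > (0:ℝ), ∀ᶠ ε in nhdsWithin (0:ℝ) (Set.Ioi 0),
    -δ ≤ (M.costJ ν (oplus (πp ε) π (t + ε)) (μp ε) t t - M.costJ ν π μ₀ t t) / ε

end TIModel

/-- A nonnegative continuous function dominated by a multiple of its own integral vanishes. -/
lemma eq_zero_of_le_mul_integral {u : ℝ → ℝ} {a b C : ℝ} (hab : a ≤ b)
    (hu : ContinuousOn u (Icc a b)) (hpos : ∀ r ∈ Icc a b, 0 ≤ u r)
    (hle : ∀ r ∈ Icc a b, u r ≤ C * ∫ s in a..r, u s) :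
    u b = 0 := by
  have hInt : IntervalIntegrable u volume a b :=
    ContinuousOn.intervalIntegrable (by rwa [uIcc_of_le hab])
  have hVpos : ∀ r ∈ Icc a b, 0 ≤ ∫ s in a..r, u s := fun r hr =>
    intervalIntegral.integral_nonneg hr.1 fun s hs => hpos s ⟨hs.1, hs.2.trans hr.2⟩
  have hVcont : ContinuousOn (fun r => ∫ s in a..r, u s) (Icc a b) := by
    have := intervalIntegral.continuousOn_primitive_interval' hInt left_mem_uIcc
    rwa [uIcc_of_le hab] at this
  have hderiv : ∀ x ∈ Ico a b,
      HasDerivWithinAt (fun r => ∫ s in a..r, u s) (u x) (Ici x) x := by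
    intro x hx
    have hmem : Icc a b ∈ 𝓝[>] x :=
      mem_of_superset (Ioc_mem_nhdsGT hx.2) fun y hy => ⟨hx.1.trans hy.1.le, hy.2⟩
    refine intervalIntegral.integral_hasDerivWithinAt_right
      (hInt.mono_set (by
        rw [uIcc_of_le hab, uIcc_of_le hx.1]; exact Icc_subset_Icc_right hx.2.le))
      (t := Ioi x) ?_ ?_
    · exact ⟨Icc a b, hmem, hu.aestronglyMeasurable measurableSet_Icc⟩
    · exact (hu x ⟨hx.1, hx.2.le⟩).mono_of_mem_nhdsWithin hmem
  have hzero := norm_le_gronwallBound_of_norm_deriv_right_le (δ := 0) (K := C) (ε := 0)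
    hVcont hderiv (by simp) (by
      intro x hx
      have hx' : x ∈ Icc a b := ⟨hx.1, hx.2.le⟩
      rw [Real.norm_of_nonneg (hpos x hx'), Real.norm_of_nonneg (hVpos x hx'), add_zero]
      exact hle x hx') b (right_mem_Icc.2 hab)
  rw [gronwallBound_ε0_δ0, norm_le_zero_iff] at hzero
  refine le_antisymm ?_ (hpos b (right_mem_Icc.2 hab))
  simpa [hzero] using hle b (right_mem_Icc.2 hab)

/-- A minimum principle for backward linear systems driven by bounded rate matrices. The
integral equation is only required where its integrand is integrable. -/
lemma nonneg_of_backward_rate_system {ι : Type*} [Fintype ι] {a b K : ℝ}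
    {Q : ℝ → ι → ι → ℝ} {y h : ℝ → ι → ℝ}
    (hQ : ∀ s ∈ Icc a b, ∀ i j, j ≠ i → 0 ≤ Q s i j)
    (hQsum : ∀ s ∈ Icc a b, ∀ i, ∑ j, Q s i j = 0)
    (hQbdd : ∀ s ∈ Icc a b, ∀ i, |Q s i i| ≤ K)
    (hy : ∀ i, ContinuousOn (fun s => y s i) (Icc a b))
    (heq : ∀ s ∈ Icc a b, ∀ i, IntervalIntegrable (fun r => h r i) volume s b →
      y s i = y b i + ∫ r in s..b, h r i)
    (hnot : ∀ s ∈ Icc a b, ∀ i, ¬ IntervalIntegrable (fun r => h r i) volume s b →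
      y b i ≤ y s i)
    (hh : ∀ s ∈ Icc a b, ∀ i, ∑ j, Q s i j * y s j ≤ h s i)
    (hb : ∀ i, 0 ≤ y b i) {t : ℝ} (ht : t ∈ Icc a b) (i : ι) :
    0 ≤ y t i := by
  classical
  choose σ hσ hσmin using fun j => isCompact_Icc.exists_isMinOn ⟨t, ht⟩ (hy j)
  obtain ⟨k, -, hk⟩ :=
    Finset.exists_min_image Finset.univ (fun j => y (σ j) j) ⟨i, Finset.mem_univ i⟩
  have hmin : ∀ s ∈ Icc a b, ∀ j, y (σ k) k ≤ y s j := fun s hs j =>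
    (hk j (Finset.mem_univ j)).trans (hσmin j hs)
  refine le_trans ?_ (hmin t ht i)
  set μ := y (σ k) k with hμ
  by_cases hint : IntervalIntegrable (fun r => h r k) volume (σ k) b
  swap
  · exact (hb k).trans (hnot _ (hσ k) k hint)
  have hsub : Icc (σ k) b ⊆ Icc a b := Icc_subset_Icc_left (hσ k).1
  have hlower : ∀ s ∈ Icc a b, -K * (y s k - μ) ≤ h s k := by
    intro s hs
    refine le_trans ?_ (hh s hs k)
    have hshift : ∑ j, Q s k j * y s j = ∑ j, Q s k j * (y s j - μ) := by
      simp only [mul_sub, Finset.sum_sub_distrib, ← Finset.sum_mul, hQsum s hs k, zero_mul,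
        sub_zero]
    rw [hshift, ← Finset.add_sum_erase _ _ (Finset.mem_univ k)]
    have hoff : 0 ≤ ∑ j ∈ Finset.univ.erase k, Q s k j * (y s j - μ) :=
      Finset.sum_nonneg fun j hj =>
        mul_nonneg (hQ s hs k j (Finset.ne_of_mem_erase hj)) (sub_nonneg.2 (hmin s hs j))
    have hdiag : -K * (y s k - μ) ≤ Q s k k * (y s k - μ) :=
      mul_le_mul_of_nonneg_right (abs_le.1 (hQbdd s hs k)).1 (sub_nonneg.2 (hmin s hs k))
    linarith
  have hcont : ContinuousOn (fun s => y s k - μ) (Icc (σ k) b) :=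
    ((hy k).mono hsub).sub continuousOn_const
  have hvanish := eq_zero_of_le_mul_integral (C := K) (hσ k).2 hcont
    (fun r hr => sub_nonneg.2 (hmin r (hsub hr) k)) (by
      intro r hr
      have hra : r ∈ Icc a b := hsub hr
      have hr' : r ∈ uIcc (σ k) b := by rwa [uIcc_of_le (hσ k).2]
      have hint₁ := hint.mono_set (uIcc_subset_uIcc_left hr')
      have hint₂ := hint.mono_set (uIcc_subset_uIcc_right hr')
      have hsplit := intervalIntegral.integral_add_adjacent_intervals hint₁ hint₂
      have hmono : ∫ s in (σ k)..r, -K * (y s k - μ) ≤ ∫ s in (σ k)..r, h s k := by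
        refine intervalIntegral.integral_mono_on hr.1 ?_ hint₁
          fun s hs => hlower s (hsub ⟨hs.1, hs.2.trans hr.2⟩)
        refine ContinuousOn.intervalIntegrable ?_
        rw [uIcc_of_le hr.1]
        exact continuousOn_const.mul (hcont.mono (Icc_subset_Icc_right hr.2))
      rw [intervalIntegral.integral_const_mul] at hmono
      have h1 := heq _ (hσ k) k hint
      have h2 := heq r hra k hint₂
      linarith)
  linarith [hb k]

/-- Proposition 3.1 of the paper. Under Assumptions (A), (B), (C),
there is a constant `κ > 0`, independent of the choice of the continuous prior curve
`ν`, such that every solution `(Θ, π)` of the time-inconsistent Hamilton-Jacobi system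
with prior `ν` satisfies `0 ≤ Θ_{τ,t}(i) ≤ κ` for all `τ, t ∈ [0,T]` and `i`. -/
theorem HJ_solution_uniformly_bounded
    {m : ℕ} (hm : 0 < m) {U : Type*} [MetricSpace U] (M : TIModel m U) :
    ∃ κ : ℝ, 0 < κ ∧
      ∀ ν : ℝ → Fin m → ℝ, M.IsContinuousPrior ν →
        ∀ (Θ : ℝ → ℝ → Fin m → ℝ) (π : ℝ → Fin m → U), M.IsHJSol ν Θ π →
          ∀ τ ∈ Set.Icc (0:ℝ) M.T, ∀ t ∈ Set.Icc (0:ℝ) M.T, ∀ i,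
            0 ≤ Θ τ t i ∧ Θ τ t i ≤ κ := by
  refine ⟨|M.K₂| + (M.K₁ + |M.K₂|) * M.T + 1, ?_, ?_⟩
  · have := M.K₁_pos
    have := M.T_pos
    positivity
  rintro ν hν Θ π ⟨hπ, hcont, -, hΘ⟩ τ hτ t ht i
  have hprob := hν.1
  have hTmem : M.T ∈ Icc (0:ℝ) M.T := right_mem_Icc.2 M.T_pos.le
  have hg0 := fun i => M.g_nonneg τ i (ν M.T) (hprob _ hTmem)
  have hgK := fun i => (M.g_le τ i (ν M.T) (hprob _ hTmem)).trans (le_abs_self _)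
  have hK : 0 ≤ M.K₁ + |M.K₂| := add_nonneg M.K₁_pos.le (abs_nonneg _)
  have hπmem : ∀ s ∈ Icc (0:ℝ) M.T, ∀ i, π s i ∈ M.Uset s i := fun s hs i => by
    rw [hπ s hs i]; exact M.ψ_mem s hs _ i
  set h : ℝ → Fin m → ℝ := fun s i =>
    (M.fbar τ s i (ν s) + M.Ψ s i (π s i)) + ∑ j, M.q s i (π s i) j * Θ τ s j with hh
  have hQ : ∀ s ∈ Icc (0:ℝ) M.T, ∀ i j, j ≠ i → 0 ≤ M.q s i (π s i) j :=
    fun s hs i j hij => M.q_nonneg s hs i _ (hπmem s hs i) j hij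
  have hQsum : ∀ s ∈ Icc (0:ℝ) M.T, ∀ i, ∑ j, M.q s i (π s i) j = 0 :=
    fun s hs i => M.q_rowsum s hs i _ (hπmem s hs i)
  have hQbdd : ∀ s ∈ Icc (0:ℝ) M.T, ∀ i, |M.q s i (π s i) i| ≤ M.K₁ :=
    fun s hs i => M.q_bdd s hs i i _ (hπmem s hs i)
  have hterm : ∀ i, Θ τ M.T i = M.g τ i (ν M.T) := fun i => by
    simpa using hΘ τ hτ M.T hTmem i
  have hΘeq : ∀ s ∈ Icc (0:ℝ) M.T, ∀ i, Θ τ s i = Θ τ M.T i + ∫ r in s..M.T, h r i :=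
    fun s hs i => by rw [hterm]; exact hΘ τ hτ s hs i
  constructor
  · refine nonneg_of_backward_rate_system (Q := fun s i j => M.q s i (π s i) j) (h := h)
      hQ hQsum hQbdd (hcont τ hτ) (fun s hs i _ => hΘeq s hs i) ?_ ?_
      (fun i => (hg0 i).trans_eq (hterm i).symm) ht i
    · intro s hs i hn
      rw [hΘeq s hs i, intervalIntegral.integral_undef hn, add_zero]
    · intro s hs i
      have h1 := M.fbar_nonneg τ s i (ν s) (hprob s hs)
      have h2 := M.Ψ_nonneg s hs i _ (hπmem s hs i)
      simp only [hh]
      linarith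
  · have hupper := nonneg_of_backward_rate_system
      (Q := fun s i j => M.q s i (π s i) j)
      (y := fun s i => (|M.K₂| + (M.K₁ + |M.K₂|) * (M.T - s)) - Θ τ s i)
      (h := fun s i => (M.K₁ + |M.K₂|) - h s i)
      hQ hQsum hQbdd
      (fun i => (by fun_prop : Continuous fun s : ℝ =>
        |M.K₂| + (M.K₁ + |M.K₂|) * (M.T - s)).continuousOn.sub (hcont τ hτ i))
      ?_ ?_ ?_ ?_ ht i
    · have := mul_nonneg hK ht.1
      linarith
    · intro s hs i hi
      have hi' : IntervalIntegrable (fun r => h r i) volume s M.T := by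
        simpa using (intervalIntegrable_const (c := M.K₁ + |M.K₂|)).sub hi
      rw [intervalIntegral.integral_sub intervalIntegrable_const hi',
        intervalIntegral.integral_const, smul_eq_mul, hΘeq s hs i]
      ring
    · intro s hs i hn
      have hn' : ¬ IntervalIntegrable (fun r => h r i) volume s M.T := fun hi =>
        hn (intervalIntegrable_const.sub hi)
      have := mul_nonneg hK (sub_nonneg.2 hs.2)
      rw [hΘeq s hs i, intervalIntegral.integral_undef hn']
      linarith
    · intro s hs i
      have h1 := (M.fbar_le τ s i (ν s) (hprob s hs)).trans (le_abs_self _)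
      have h2 := M.Ψ_le s hs i _ (hπmem s hs i)
      simp only [hh, mul_sub, Finset.sum_sub_distrib, ← Finset.sum_mul, hQsum s hs i]
      linarith
    · intro i
      simp only [hterm i, sub_self, mul_zero, add_zero]
      exact sub_nonneg.2 (hgK i)
end

section
/- Maximum-principle bound for the backward equation: let Q : [0,T] → (m×m real matrices) be measurable with each Q_s a generator matrix and entries bounded by K₁, let f : [0,T] × M → ℝ be measurable with 0 ≤ f_s(i) ≤ C_f for all s, i, and let g : M → ℝ with 0 ≤ g(i) ≤ C_g. If Θ : [0,T] → (M → ℝ) is continuous and satisfies Θ_t(i) = g(i) + ∫_t^T ( f_s(i) + ∑_j Q_s(i,j) Θ_s(j) ) ds for all t ∈ [0,T] and i ∈ M (equivalently, solves (d/dt)Θ_t(i) + f_t(i) + ∑_j Q_t(i,j)Θ_t(j) = 0 with Θ_T = g), then 0 ≤ Θ_t(i) ≤ (T − t)·C_f + C_g for all t ∈ [0,T] and i ∈ M. -/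
open MeasureTheory Set

open scoped Topology

/-- Strict minimum principle: a supersolution of the backward equation of a bounded generator, with
source at least `ε > 0` and positive terminal value, is positive. -/
theorem backward_supersolution_pos {ι : Type*} [Fintype ι] {T K ε : ℝ} (hε : 0 < ε)
    {Q : ℝ → Matrix ι ι ℝ}
    (hQ_offdiag : ∀ s ∈ Icc (0 : ℝ) T, ∀ i j, j ≠ i → 0 ≤ Q s i j)
    (hQ_diag : ∀ s ∈ Icc (0 : ℝ) T, ∀ i, |Q s i i| ≤ K)
    {w G : ℝ → ι → ℝ} (hw : ∀ i, ContinuousOn (fun t => w t i) (Icc 0 T))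
    (hG : ∀ i, IntervalIntegrable (fun s => G s i) volume 0 T)
    (hwG : ∀ t ∈ Icc (0 : ℝ) T, ∀ i, w t i = w T i + ∫ s in t..T, G s i)
    (hQG : ∀ s ∈ Icc (0 : ℝ) T, ∀ i, ε + ∑ j, Q s i j * w s j ≤ G s i)
    (hwT : ∀ i, 0 < w T i) :
    ∀ t ∈ Icc (0 : ℝ) T, ∀ i, 0 < w t i := by
  classical
  by_contra! hneg
  obtain ⟨t, ht, i, hti⟩ := hneg
  set S : Set ℝ := ⋃ i, {t ∈ Icc (0 : ℝ) T | w t i ≤ 0}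
  have hSclosed : IsClosed S := isClosed_iUnion_of_finite fun i =>
    (hw i).preimage_isClosed_of_isClosed isClosed_Icc isClosed_Iic
  have hSbdd : BddAbove S := ⟨T, by
    rintro s hs
    obtain ⟨j, hj⟩ := mem_iUnion.1 hs
    exact hj.1.2⟩
  have hmem : sSup S ∈ S := hSclosed.csSup_mem ⟨t, mem_iUnion.2 ⟨i, ht, hti⟩⟩ hSbdd
  set a := sSup S
  obtain ⟨i, haI, hai⟩ := mem_iUnion.1 hmem
  have hpos : ∀ s ∈ Icc (0 : ℝ) T, a < s → ∀ j, 0 < w s j := by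
    intro s hs has j
    by_contra! h
    exact has.not_ge (le_csSup hSbdd (mem_iUnion.2 ⟨j, hs, h⟩))
  have haT : a < T := by
    refine lt_of_le_of_ne haI.2 fun h => ?_
    rw [h] at hai
    exact (hwT i).not_ge hai
  have hK : 0 ≤ K := (abs_nonneg _).trans (hQ_diag a haI i)
  have hη : 0 < ε / (K + 1) := by positivity
  have hnear : ∀ᶠ s in 𝓝[Icc 0 T] a, w s i < ε / (K + 1) :=
    (hw i a haI).eventually (gt_mem_nhds (hai.trans_lt hη))
  obtain ⟨δ, hδ, hball⟩ := Metric.mem_nhdsWithin_iff.1 hnear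
  obtain ⟨b, hab, hb⟩ := exists_between (lt_min haT (lt_add_of_pos_right a hδ))
  have hbT : b < T := hb.trans_le (min_le_left _ _)
  have hbδ : b < a + δ := hb.trans_le (min_le_right _ _)
  have hbI : b ∈ Icc (0 : ℝ) T := ⟨haI.1.trans hab.le, hbT.le⟩
  have hGnonneg : ∀ s ∈ Ioc a b, 0 ≤ G s i := by
    intro s hs
    have hsI : s ∈ Icc (0 : ℝ) T := ⟨haI.1.trans hs.1.le, hs.2.trans hbT.le⟩
    have hws : w s i < ε / (K + 1) := hball ⟨by
      rw [Metric.mem_ball, Real.dist_eq, abs_lt]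
      constructor <;> linarith [hs.1, hs.2], hsI⟩
    have hws0 := hpos s hsI hs.1
    rw [lt_div_iff₀ (by positivity)] at hws
    have hoff : 0 ≤ ∑ j ∈ Finset.univ.erase i, Q s i j * w s j :=
      Finset.sum_nonneg fun j hj =>
        mul_nonneg (hQ_offdiag s hsI i j (Finset.ne_of_mem_erase hj)) (hws0 j).le
    have hsum := Finset.add_sum_erase Finset.univ (fun j => Q s i j * w s j) (Finset.mem_univ i)
    have hdiag := mul_le_mul_of_nonneg_right (abs_le.1 (hQ_diag s hsI i)).1 (hws0 i).le
    have hGs := hQG s hsI i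
    nlinarith [hws0 i]
  have h0T : (0 : ℝ) ≤ T := haI.1.trans haI.2
  have hint : ∀ x ∈ Icc (0 : ℝ) T, ∀ y ∈ Icc (0 : ℝ) T,
      IntervalIntegrable (fun s => G s i) volume x y := fun x hx y hy =>
    (hG i).mono_set (uIcc_subset_uIcc (by rwa [uIcc_of_le h0T]) (by rwa [uIcc_of_le h0T]))
  have hsplit := intervalIntegral.integral_add_adjacent_intervals (hint a haI b hbI)
    (hint b hbI T ⟨h0T, le_rfl⟩)
  have hInt : 0 ≤ ∫ s in a..b, G s i := by
    rw [intervalIntegral.integral_of_le hab.le]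
    exact setIntegral_nonneg measurableSet_Ioc hGnonneg
  linarith [hwG a haI i, hwG b hbI i, hpos b hbI hab i]

/-- Minimum principle: a supersolution of the backward equation of a bounded generator with
nonnegative terminal value is nonnegative. -/
theorem backward_supersolution_nonneg {ι : Type*} [Fintype ι] {T K : ℝ}
    {Q : ℝ → Matrix ι ι ℝ}
    (hQ_offdiag : ∀ s ∈ Icc (0 : ℝ) T, ∀ i j, j ≠ i → 0 ≤ Q s i j)
    (hQ_rowsum : ∀ s ∈ Icc (0 : ℝ) T, ∀ i, ∑ j, Q s i j = 0)
    (hQ_diag : ∀ s ∈ Icc (0 : ℝ) T, ∀ i, |Q s i i| ≤ K)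
    {u G : ℝ → ι → ℝ} (hu : ∀ i, ContinuousOn (fun t => u t i) (Icc 0 T))
    (hG : ∀ i, IntervalIntegrable (fun s => G s i) volume 0 T)
    (huG : ∀ t ∈ Icc (0 : ℝ) T, ∀ i, u t i = u T i + ∫ s in t..T, G s i)
    (hQG : ∀ s ∈ Icc (0 : ℝ) T, ∀ i, ∑ j, Q s i j * u s j ≤ G s i)
    (huT : ∀ i, 0 ≤ u T i) :
    ∀ t ∈ Icc (0 : ℝ) T, ∀ i, 0 ≤ u t i := by
  intro t ht i
  have hperturbed : ∀ ε > 0, 0 < u t i + ε * (1 + (T - t)) := by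
    intro ε hε
    refine backward_supersolution_pos (w := fun t i => u t i + ε * (1 + (T - t)))
      (G := fun s i => G s i + ε) hε hQ_offdiag hQ_diag (fun i => (hu i).add (by fun_prop))
      (fun i => (hG i).add intervalIntegrable_const) ?_ ?_ ?_ t ht i
    · intro t ht i
      have hGt : IntervalIntegrable (fun s => G s i) volume t T :=
        (hG i).mono_set (uIcc_subset_uIcc (by rwa [uIcc_of_le (ht.1.trans ht.2)]) right_mem_uIcc)
      rw [intervalIntegral.integral_add hGt intervalIntegrable_const,
        intervalIntegral.integral_const, huG t ht i, smul_eq_mul]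
      ring
    · intro s hs i
      have : ∑ j, Q s i j * (u s j + ε * (1 + (T - s))) = ∑ j, Q s i j * u s j := by
        simp_rw [mul_add (Q s i _) (u s _)]
        rw [Finset.sum_add_distrib, ← Finset.sum_mul, hQ_rowsum s hs i, zero_mul, add_zero]
      linarith [hQG s hs i]
    · intro i
      have := huT i
      simp only [sub_self]
      linarith
  by_contra! hneg
  have hpos : 0 < 1 + (T - t) := by linarith [ht.2]
  have h := hperturbed (-u t i / (1 + (T - t))) (div_pos (neg_pos.2 hneg) hpos)
  rw [div_mul_cancel₀ _ hpos.ne'] at h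
  linarith

/-- maximum-principle bound for the backward equation. If `Q_s` are
generator matrices with entries bounded by `K₁`, `0 ≤ f_s(i) ≤ C_f`, `0 ≤ g(i) ≤ C_g`,
and the continuous function `Θ` satisfies
`Θ_t(i) = g(i) + ∫_t^T (f_s(i) + ∑_j Q_s(i,j) Θ_s(j)) ds`, then
`0 ≤ Θ_t(i) ≤ (T - t)·C_f + C_g` on `[0,T]`. -/
theorem backward_equation_maximum_principle
    {m : ℕ} (hm : 0 < m) (T : ℝ) (hT : 0 < T) (K₁ C_f C_g : ℝ)
    (hCf : 0 ≤ C_f) (hCg : 0 ≤ C_g)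
    (Q : ℝ → Matrix (Fin m) (Fin m) ℝ)
    (hQmeas : ∀ i j, Measurable fun s => Q s i j)
    (hQgen_offdiag : ∀ s ∈ Set.Icc (0:ℝ) T, ∀ i j, j ≠ i → 0 ≤ Q s i j)
    (hQgen_rowsum : ∀ s ∈ Set.Icc (0:ℝ) T, ∀ i, ∑ j, Q s i j = 0)
    (hQbdd : ∀ s ∈ Set.Icc (0:ℝ) T, ∀ i j, |Q s i j| ≤ K₁)
    (f : ℝ → Fin m → ℝ)
    (hfmeas : ∀ i, Measurable fun s => f s i)
    (hf : ∀ s ∈ Set.Icc (0:ℝ) T, ∀ i, 0 ≤ f s i ∧ f s i ≤ C_f)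
    (g : Fin m → ℝ) (hg : ∀ i, 0 ≤ g i ∧ g i ≤ C_g)
    (Θ : ℝ → Fin m → ℝ)
    (hΘcont : ∀ i, ContinuousOn (fun t => Θ t i) (Set.Icc (0:ℝ) T))
    (hΘ : ∀ t ∈ Set.Icc (0:ℝ) T, ∀ i,
      Θ t i = g i + ∫ s in t..T, (f s i + ∑ j, Q s i j * Θ s j)) :
    ∀ t ∈ Set.Icc (0:ℝ) T, ∀ i, 0 ≤ Θ t i ∧ Θ t i ≤ (T - t) * C_f + C_g := by
  have hF : ∀ i, IntervalIntegrable (fun s => f s i + ∑ j, Q s i j * Θ s j) volume 0 T := by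
    intro i
    rw [intervalIntegrable_iff_integrableOn_Icc_of_le hT.le]
    refine Integrable.add ?_ (integrable_finsetSum _ fun j _ => ?_)
    · refine Measure.integrableOn_of_bounded (M := C_f) measure_Icc_lt_top.ne
        (hfmeas i).aestronglyMeasurable ?_
      filter_upwards [ae_restrict_mem measurableSet_Icc] with s hs
      rw [Real.norm_of_nonneg (hf s hs i).1]
      exact (hf s hs i).2
    · refine ((hΘcont j).integrableOn_Icc).bdd_mul (c := K₁)
        (hQmeas i j).aestronglyMeasurable ?_
      filter_upwards [ae_restrict_mem measurableSet_Icc] with s hs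
      exact hQbdd s hs i j
  have hΘT : ∀ i, Θ T i = g i := fun i => by
    simpa using hΘ T ⟨hT.le, le_rfl⟩ i
  have hdiag : ∀ s ∈ Icc (0 : ℝ) T, ∀ i, |Q s i i| ≤ K₁ := fun s hs i => hQbdd s hs i i
  have hlower := backward_supersolution_nonneg hQgen_offdiag hQgen_rowsum hdiag hΘcont hF
    (fun t ht i => by rw [hΘT i]; exact hΘ t ht i)
    (fun s hs i => le_add_of_nonneg_left (hf s hs i).1) (fun i => by rw [hΘT i]; exact (hg i).1)
  have hupper := backward_supersolution_nonneg hQgen_offdiag hQgen_rowsum hdiag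
    (u := fun t i => ((T - t) * C_f + C_g) - Θ t i)
    (G := fun s i => C_f - (f s i + ∑ j, Q s i j * Θ s j))
    (fun i => ContinuousOn.sub (by fun_prop) (hΘcont i))
    (fun i => intervalIntegrable_const.sub (hF i))
    (by
      intro t ht i
      have hFt : IntervalIntegrable (fun s => f s i + ∑ j, Q s i j * Θ s j) volume t T :=
        (hF i).mono_set (uIcc_subset_uIcc (by rwa [uIcc_of_le hT.le]) right_mem_uIcc)
      rw [intervalIntegral.integral_sub intervalIntegrable_const hFt,
        intervalIntegral.integral_const, hΘ t ht i, hΘT i, smul_eq_mul]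
      ring)
    (by
      intro s hs i
      simp_rw [mul_sub (Q s i _) ((T - s) * C_f + C_g)]
      rw [Finset.sum_sub_distrib, ← Finset.sum_mul, hQgen_rowsum s hs i]
      linarith [(hf s hs i).2])
    (fun i => by
      have := (hg i).2
      simp only [sub_self, hΘT i]
      linarith)
  exact fun t ht i => ⟨hlower t ht i, sub_nonneg.1 (hupper t ht i)⟩
end

section
/- Right-continuity with left limits of the diagonal: let p_{t,s}(i,j) ∈ [0,1] (for 0 ≤ t ≤ s ≤ T, i,j ∈ M) be given, let f : [0,T]² × M → ℝ be bounded and measurable in s with τ ↦ f_{τ,s}(j) right-continuous with left limits for each fixed (s,j), and let g : [0,T] × M → ℝ be bounded with τ ↦ g_τ(j) right-continuous with left limits for each j. Define Θ_{τ,t}(i) = ∫_t^T ∑_j p_{t,s}(i,j) f_{τ,s}(j) ds + ∑_j p_{t,T}(i,j) g_τ(j), and assume that for each fixed τ the map t ↦ Θ_{τ,t}(i) is continuous on [0,T] for every i. Then for each i ∈ M the diagonal map t ↦ Θ_{t,t}(i) is right-continuous with left limits on [0,T]. -/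
open MeasureTheory Filter Set Topology

/-- A double family `Θ τ t` that is continuous in `t`, with oscillation in `τ` controlled
uniformly in `t` by a quantity vanishing along `l ×ˢ l`, has a diagonal limit along `l`. -/
theorem exists_tendsto_diagonal_of_uniform_bound {Θ D : ℝ → ℝ → ℝ} {S : Set ℝ} {t₀ : ℝ}
    {l : Filter ℝ} [l.NeBot] (hlS : S ∈ l) (hl : l ≤ 𝓝[S] t₀) (ht₀ : t₀ ∈ S)
    (hD : Tendsto (fun q : ℝ × ℝ => D q.1 q.2) (l ×ˢ l) (𝓝 0))
    (hΘD : ∀ τ σ, ∀ t ∈ S, |Θ τ t - Θ σ t| ≤ D τ σ)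
    (hΘ : ∀ σ ∈ S, ContinuousOn (Θ σ) S) :
    ∃ L, Tendsto (fun t => Θ t t) l (𝓝 L) := by
  refine cauchy_map_iff_exists_tendsto.mp ?_
  rw [Metric.cauchy_iff]
  refine ⟨inferInstance, fun ε hε => ?_⟩
  have hsmall : ∀ᶠ q : ℝ × ℝ in l ×ˢ l, D q.1 q.2 < ε / 4 :=
    hD.eventually_lt_const (by positivity)
  obtain ⟨u, hu, v, hv, huv⟩ := eventually_prod_iff.mp hsmall
  obtain ⟨σ, hσv, hσS⟩ := (hv.and hlS).exists
  have hconv : Tendsto (Θ σ) l (𝓝 (Θ σ t₀)) := (hΘ σ hσS t₀ ht₀).mono_left hl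
  have hball : ∀ᶠ t in l, dist (Θ σ t) (Θ σ t₀) < ε / 4 :=
    hconv.eventually (Metric.ball_mem_nhds _ (by positivity))
  have key : ∀ᶠ t in l, |Θ t t - Θ σ t₀| < ε / 2 := by
    filter_upwards [hu, hlS, hball] with t htu htS hb
    have h₁ := hΘD t σ t htS
    have h₂ := huv htu hσv
    rw [Real.dist_eq] at hb
    have h₃ := abs_sub_le (Θ t t) (Θ σ t) (Θ σ t₀)
    dsimp only at h₂
    linarith
  refine ⟨Metric.ball (Θ σ t₀) (ε / 2), ?_, ?_⟩
  · rw [mem_map]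
    filter_upwards [key] with t ht
    simpa [Real.dist_eq] using ht
  · intro x hx y hy
    have h := dist_triangle_right x y (Θ σ t₀)
    rw [Metric.mem_ball] at hx hy
    linarith

/-- Convergence of bounded `f τ s j` and `g τ j` along `l` makes their total oscillation,
integrated in `s`, vanish along `l ×ˢ l`. -/
theorem tendsto_oscillation_zero {m : ℕ} {T : ℝ} {f : ℝ → ℝ → Fin m → ℝ} {C : ℝ}
    (hfbdd : ∀ τ s j, |f τ s j| ≤ C) (hfmeas : ∀ τ j, Measurable fun s => f τ s j)
    {g : ℝ → Fin m → ℝ} {l : Filter ℝ} [l.IsCountablyGenerated]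
    (hf : ∀ s j, ∃ L, Tendsto (fun τ => f τ s j) l (𝓝 L))
    (hg : ∀ j, ∃ L, Tendsto (fun τ => g τ j) l (𝓝 L)) :
    Tendsto (fun q : ℝ × ℝ => (∫ s in (0:ℝ)..T, ∑ j, |f q.1 s j - f q.2 s j|)
      + ∑ j, |g q.1 j - g q.2 j|) (l ×ˢ l) (𝓝 0) := by
  have osc : ∀ h : ℝ → ℝ, (∃ L, Tendsto h l (𝓝 L)) →
      Tendsto (fun q : ℝ × ℝ => |h q.1 - h q.2|) (l ×ˢ l) (𝓝 0) := by
    rintro h ⟨L, hL⟩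
    simpa using ((hL.comp tendsto_fst).sub (hL.comp tendsto_snd)).abs
  have hI : Tendsto (fun q : ℝ × ℝ => ∫ s in (0:ℝ)..T, ∑ j, |f q.1 s j - f q.2 s j|)
      (l ×ˢ l) (𝓝 (∫ _ in (0:ℝ)..T, (0:ℝ))) := by
    refine intervalIntegral.tendsto_integral_filter_of_dominated_convergence
      (fun _ => ∑ _j : Fin m, (C + C)) (Eventually.of_forall fun q => ?_)
      (Eventually.of_forall fun q => Eventually.of_forall fun s _ => ?_)
      intervalIntegrable_const (Eventually.of_forall fun s _ => ?_)
    · exact (Finset.measurable_sum _ fun j _ =>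
        ((hfmeas q.1 j).sub (hfmeas q.2 j)).abs).aestronglyMeasurable
    · rw [Real.norm_of_nonneg (Finset.sum_nonneg fun j _ => abs_nonneg _)]
      refine Finset.sum_le_sum fun j _ => (abs_sub _ _).trans ?_
      exact add_le_add (hfbdd _ _ _) (hfbdd _ _ _)
    · simpa using tendsto_finsetSum Finset.univ fun j _ => osc (fun τ => f τ s j) (hf s j)
  have hG := tendsto_finsetSum Finset.univ fun j _ => osc (fun τ => g τ j) (hg j)
  simpa using hI.add hG

/-- Weights in `[0,1]` do not increase the oscillation of the data. -/
theorem abs_weighted_sub_le {m : ℕ} {T t : ℝ} (ht : t ∈ Set.Icc (0:ℝ) T)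
    {w : ℝ → Fin m → ℝ} (hw : ∀ s ∈ Set.Icc t T, ∀ j, w s j ∈ Set.Icc (0:ℝ) 1)
    (hwmeas : ∀ j, Measurable fun s => w s j)
    {φ ψ : ℝ → Fin m → ℝ} {C : ℝ} (hφ : ∀ s j, |φ s j| ≤ C) (hψ : ∀ s j, |ψ s j| ≤ C)
    (hφmeas : ∀ j, Measurable fun s => φ s j) (hψmeas : ∀ j, Measurable fun s => ψ s j)
    (γ δ : Fin m → ℝ) :
    |((∫ s in t..T, ∑ j, w s j * φ s j) + ∑ j, w T j * γ j)
      - ((∫ s in t..T, ∑ j, w s j * ψ s j) + ∑ j, w T j * δ j)|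
      ≤ (∫ s in (0:ℝ)..T, ∑ j, |φ s j - ψ s j|) + ∑ j, |γ j - δ j| := by
  have hint : ∀ χ : ℝ → Fin m → ℝ, (∀ s j, |χ s j| ≤ C) → (∀ j, Measurable fun s => χ s j) →
      IntervalIntegrable (fun s => ∑ j, w s j * χ s j) volume t T := by
    intro χ hχ hχm
    refine (intervalIntegrable_const (c := ∑ _j : Fin m, C)).mono_fun
      (Finset.measurable_sum _ fun j _ => (hwmeas j).mul (hχm j)).aestronglyMeasurable ?_
    refine (ae_restrict_iff' measurableSet_uIoc).mpr (Eventually.of_forall fun s hs => ?_)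
    rw [uIoc_of_le ht.2] at hs
    refine ((Finset.abs_sum_le_sum_abs _ _).trans (Finset.sum_le_sum fun j _ => ?_)).trans
      (le_abs_self _)
    obtain ⟨h₀, h₁⟩ := hw s (Ioc_subset_Icc_self hs) j
    rw [abs_mul, abs_of_nonneg h₀]
    exact (mul_le_of_le_one_left (abs_nonneg _) h₁).trans (hχ s j)
  have hosc : IntervalIntegrable (fun s => ∑ j, |φ s j - ψ s j|) volume 0 T := by
    refine (intervalIntegrable_const (c := ∑ _j : Fin m, (C + C))).mono_fun
      (Finset.measurable_sum _ fun j _ =>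
        ((hφmeas j).sub (hψmeas j)).abs).aestronglyMeasurable (Eventually.of_forall fun s => ?_)
    dsimp only
    rw [Real.norm_of_nonneg (Finset.sum_nonneg fun j _ => abs_nonneg _)]
    refine (Finset.sum_le_sum fun j _ => (abs_sub _ _).trans ?_).trans (le_abs_self _)
    exact add_le_add (hφ _ _) (hψ _ _)
  have hpt : ∀ s ∈ Set.Icc t T, ∀ a b : Fin m → ℝ,
      |∑ j, w s j * a j - ∑ j, w s j * b j| ≤ ∑ j, |a j - b j| := by
    intro s hs a b
    rw [← Finset.sum_sub_distrib]
    refine (Finset.abs_sum_le_sum_abs _ _).trans (Finset.sum_le_sum fun j _ => ?_)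
    obtain ⟨h₀, h₁⟩ := hw s hs j
    rw [← mul_sub, abs_mul, abs_of_nonneg h₀]
    exact mul_le_of_le_one_left (abs_nonneg _) h₁
  rw [add_sub_add_comm, ← intervalIntegral.integral_sub (hint φ hφ hφmeas) (hint ψ hψ hψmeas)]
  refine (abs_add_le _ _).trans (add_le_add ?_ (hpt T ⟨ht.2, le_rfl⟩ γ δ))
  refine (intervalIntegral.norm_integral_le_of_norm_le
    (f := fun s => ∑ j, w s j * φ s j - ∑ j, w s j * ψ s j) ht.2 (Eventually.of_forall fun s hs =>
    hpt s (Ioc_subset_Icc_self hs) (φ s) (ψ s)) (hosc.mono_set ?_)).trans ?_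
  · rw [uIcc_of_le ht.2, uIcc_of_le (ht.1.trans ht.2)]
    exact Icc_subset_Icc_left ht.1
  · exact intervalIntegral.integral_mono_interval ht.1 ht.2 le_rfl
      (Eventually.of_forall fun s => Finset.sum_nonneg fun j _ => abs_nonneg _) hosc

/-- right-continuity with left limits of the diagonal. If
`Θ_{τ,t}(i) = ∫_t^T ∑_j p_{t,s}(i,j) f_{τ,s}(j) ds + ∑_j p_{t,T}(i,j) g_τ(j)` with
`p ∈ [0,1]`, `f` bounded and measurable in `s` and càdlàg in `τ`, `g` bounded and càdlàg
in `τ`, and `t ↦ Θ_{τ,t}(i)` is continuous for each fixed `τ`, then the diagonal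
`t ↦ Θ_{t,t}(i)` is right-continuous with left limits on `[0,T]`. -/
theorem diagonal_rcll
    {m : ℕ} (hm : 0 < m) (T : ℝ) (hT : 0 < T)
    (p : ℝ → ℝ → Fin m → Fin m → ℝ)
    (hp01 : ∀ t ∈ Set.Icc (0:ℝ) T, ∀ s ∈ Set.Icc t T, ∀ i j, p t s i j ∈ Set.Icc (0:ℝ) 1)
    (hpmeas : ∀ t i j, Measurable fun s => p t s i j)
    (f : ℝ → ℝ → Fin m → ℝ) (C_f : ℝ)
    (hfbdd : ∀ τ s j, |f τ s j| ≤ C_f)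
    (hfmeas : ∀ τ j, Measurable fun s => f τ s j)
    (hfrcll : ∀ s j, RCLLOn (fun τ => f τ s j) T)
    (g : ℝ → Fin m → ℝ) (C_g : ℝ)
    (hgbdd : ∀ τ j, |g τ j| ≤ C_g)
    (hgrcll : ∀ j, RCLLOn (fun τ => g τ j) T)
    (Θ : ℝ → ℝ → Fin m → ℝ)
    (hΘdef : ∀ τ t i, Θ τ t i =
      (∫ s in t..T, ∑ j, p t s i j * f τ s j) + ∑ j, p t T i j * g τ j)
    (hΘcont : ∀ τ ∈ Set.Icc (0:ℝ) T, ∀ i,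
      ContinuousOn (fun t => Θ τ t i) (Set.Icc (0:ℝ) T)) :
    ∀ i, RCLLOn (fun t => Θ t t i) T := by
  intro i
  have main : ∀ t₀ ∈ Set.Icc (0:ℝ) T, ∀ A ⊆ Set.Icc (0:ℝ) T, (𝓝[A] t₀).NeBot →
      (∀ s j, ∃ L, Tendsto (fun τ => f τ s j) (𝓝[A] t₀) (𝓝 L)) →
      (∀ j, ∃ L, Tendsto (fun τ => g τ j) (𝓝[A] t₀) (𝓝 L)) →
      ∃ L, Tendsto (fun t => Θ t t i) (𝓝[A] t₀) (𝓝 L) := by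
    intro t₀ ht₀ A hA _ hf hg
    refine exists_tendsto_diagonal_of_uniform_bound (Θ := fun τ t => Θ τ t i)
      (D := fun τ σ => (∫ s in (0:ℝ)..T, ∑ j, |f τ s j - f σ s j|) + ∑ j, |g τ j - g σ j|)
      (mem_of_superset self_mem_nhdsWithin hA) (nhdsWithin_mono _ hA) ht₀
      (tendsto_oscillation_zero (T := T) hfbdd hfmeas hf hg) (fun τ σ t ht => ?_)
      (fun σ hσ => hΘcont σ hσ i)
    simp only [hΘdef]
    exact abs_weighted_sub_le ht (fun s hs => hp01 t ht s hs i) (hpmeas t i) (hfbdd τ) (hfbdd σ)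
      (hfmeas τ) (hfmeas σ) (g τ) (g σ)
  refine ⟨fun t ht => ?_, fun t ht => ?_⟩
  · have hclosed : ∀ h : ℝ → ℝ, RCLLOn h T → ∃ L, Tendsto h (𝓝[Set.Icc t T] t) (𝓝 L) := by
      intro h hh
      refine ⟨h t, ?_⟩
      rw [← Ioc_insert_left ht.2.le]
      exact continuousWithinAt_insert_self.mpr (hh.1 t ht)
    have htmem : t ∈ Set.Icc t T := ⟨le_rfl, ht.2.le⟩
    obtain ⟨L, hL⟩ := main t ⟨ht.1, ht.2.le⟩ (Set.Icc t T) (Icc_subset_Icc_left ht.1)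
      (nhdsWithin_neBot_of_mem htmem) (fun s j => hclosed _ (hfrcll s j))
      (fun j => hclosed _ (hgrcll j))
    have hLt : Θ t t i = L := tendsto_nhds_unique (tendsto_pure_nhds (fun t => Θ t t i) t)
      (hL.mono_left (pure_le_nhdsWithin htmem))
    subst hLt
    exact hL.mono_left (nhdsWithin_mono _ Ioc_subset_Icc_self)
  · refine main t ⟨ht.1.le, ht.2⟩ (Set.Ico 0 t)
      (fun x hx => ⟨hx.1, hx.2.le.trans ht.2⟩) ?_ (fun s j => (hfrcll s j).2 t ht)
      (fun j => (hgrcll j).2 t ht)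
    rw [nhdsWithin_Ico_eq_nhdsLT ht.1]
    infer_instance
end
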